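/- Let ψ₀(x₁,x₂) = (1 − x₁² − x₂²)·(6x₁² + 3x₂² − x₂⁴ − 1) on ℝ². Then: (i) Δψ₀(x₁,x₂) = 22 − 90x₁² − 66x₂² + 12x₁²x₂² + 32x₂⁴ for all (x₁,x₂) ∈ ℝ²; (ii) for every point (x₁,x₂) on the unit circle x₁² + x₂² = 1, the radial (outward normal) derivative satisfies x₁·∂₁ψ₀ + x₂·∂₂ψ₀ = −2·(6x₁² + 3x₂² − x₂⁴ − 1) ≤ −2. -/

import Mathlib

open MeasureTheory Set Filter Topology

noncomputable section

/-- First partial derivative (in the direction `x₁`) of a function on `ℝ × ℝ`. -/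
def pd1 {E : Type*} [NormedAddCommGroup E] [NormedSpace ℝ E] (u : ℝ × ℝ → E) (x : ℝ × ℝ) : E :=
  fderiv ℝ u x (1, 0)

/-- Second partial derivative (in the direction `x₂`) of a function on `ℝ × ℝ`. -/
def pd2 {E : Type*} [NormedAddCommGroup E] [NormedSpace ℝ E] (u : ℝ × ℝ → E) (x : ℝ × ℝ) : E :=
  fderiv ℝ u x (0, 1)

/-- The Laplacian on `ℝ × ℝ`. -/
def lap (ψ : ℝ × ℝ → ℝ) (x : ℝ × ℝ) : ℝ := pd1 (pd1 ψ) x + pd2 (pd2 ψ) x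

/-- Test functions for the Dirichlet variational problems on `Ω`:
nonzero smooth compactly supported functions with support in `Ω`. -/
def IsTestFun (Ω : Set (ℝ × ℝ)) (u : ℝ × ℝ → ℂ) : Prop :=
  ContDiff ℝ (⊤ : ℕ∞) u ∧ HasCompactSupport u ∧ tsupport u ⊆ Ω ∧ u ≠ 0

/-- Rayleigh quotient of the spin-`σ` (`σ = -1` : spin-down, `σ = 1` : spin-up)
Dirichlet Pauli operator at the test function `u`. -/
def pauliRayleigh (σ : ℝ) (h : ℝ) (A : ℝ × ℝ → ℝ × ℝ) (B : ℝ × ℝ → ℝ) (Ω : Set (ℝ × ℝ))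
    (u : ℝ × ℝ → ℂ) : ℝ :=
  ((∫ x in Ω, (‖(h : ℂ) * pd1 u x - Complex.I * ((A x).1 : ℂ) * u x‖ ^ 2
      + ‖(h : ℂ) * pd2 u x - Complex.I * ((A x).2 : ℂ) * u x‖ ^ 2))
    + σ * (h * ∫ x in Ω, B x * ‖u x‖ ^ 2)) / ∫ x in Ω, ‖u x‖ ^ 2

/-- The ground state energy `λ₋^D(h,A,B,Ω)` of the spin-down Dirichlet Pauli operator. -/
def lambdaMinusD (h : ℝ) (A : ℝ × ℝ → ℝ × ℝ) (B : ℝ × ℝ → ℝ) (Ω : Set (ℝ × ℝ)) : ℝ :=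
  sInf (pauliRayleigh (-1) h A B Ω '' {u | IsTestFun Ω u})

/-- The ground state energy `λ₊^D(h,A,B,Ω)` of the spin-up Dirichlet Pauli operator. -/
def lambdaPlusD (h : ℝ) (A : ℝ × ℝ → ℝ × ℝ) (B : ℝ × ℝ → ℝ) (Ω : Set (ℝ × ℝ)) : ℝ :=
  sInf (pauliRayleigh 1 h A B Ω '' {u | IsTestFun Ω u})

/-- The ground state energy `Λ^D(h,A,B,Ω)` of the full Dirichlet Pauli operator. -/
def LambdaD (h : ℝ) (A : ℝ × ℝ → ℝ × ℝ) (B : ℝ × ℝ → ℝ) (Ω : Set (ℝ × ℝ)) : ℝ :=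
  min (lambdaMinusD h A B Ω) (lambdaPlusD h A B Ω)

/-- The canonical vector potential `∇⊥ψ = (−∂₂ψ, ∂₁ψ)`. -/
def perpGrad (ψ : ℝ × ℝ → ℝ) (x : ℝ × ℝ) : ℝ × ℝ := (-(pd2 ψ x), pd1 ψ x)

/-- `ψ` is the scalar potential of `B` on `Ω`: `ψ ∈ C⁰(closure Ω) ∩ C²(Ω)`,
`Δψ = B` in `Ω` and `ψ = 0` on `∂Ω`. -/
structure IsScalarPotential (Ω : Set (ℝ × ℝ)) (B : ℝ × ℝ → ℝ) (ψ : ℝ × ℝ → ℝ) : Prop where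
  contOn : ContinuousOn ψ (closure Ω)
  c2 : ContDiffOn ℝ 2 ψ Ω
  lap_eq : ∀ x ∈ Ω, lap ψ x = B x
  bdry : ∀ x ∈ frontier Ω, ψ x = 0

/-- `A` is a continuous vector potential for `B` on `Ω`: `∂₁A₂ − ∂₂A₁ = B`. -/
def IsVectorPotential (Ω : Set (ℝ × ℝ)) (B : ℝ × ℝ → ℝ) (A : ℝ × ℝ → ℝ × ℝ) : Prop :=
  ContinuousOn A Ω ∧ ∀ x ∈ Ω, pd1 (fun y => (A y).2) x - pd2 (fun y => (A y).1) x = B x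

/-- `γ` is a regular curve of class `C^{2,α}` on the parameter set `s`. -/
def C2HolderOn (α : ℝ) (γ : ℝ → ℝ × ℝ) (s : Set ℝ) : Prop :=
  ContDiffOn ℝ 2 γ s ∧
  (∃ C : ℝ, ∀ x ∈ s, ∀ y ∈ s,
      ‖derivWithin (derivWithin γ s) s x - derivWithin (derivWithin γ s) s y‖ ≤ C * |x - y| ^ α) ∧
  ∀ x ∈ s, derivWithin γ s x ≠ 0

/-- Near `p`, the set `Γ` is a regular curve of class `C^{2,α}`. -/
def IsLocallyC2CurveAt (α : ℝ) (Γ : Set (ℝ × ℝ)) (p : ℝ × ℝ) : Prop :=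
  ∃ ε > 0, ∃ γ : ℝ → ℝ × ℝ, C2HolderOn α γ (Icc (-1) 1) ∧ γ 0 = p ∧
    Γ ∩ Metric.ball p ε = γ '' Ioo (-1) 1 ∩ Metric.ball p ε

/-- `Γ` is (locally) a regular curve of class `C^{2,α}`. -/
def IsC2HolderSet (α : ℝ) (Γ : Set (ℝ × ℝ)) : Prop := ∀ p ∈ Γ, IsLocallyC2CurveAt α Γ p

/-- `Ω` has a corner at `p` formed by two `C^{2,α}` arcs, of aperture less than `π`
(near `p`, `Ω` is contained in a strictly convex open cone with vertex `p`). -/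
def HasConvexCornerAt (Ω : Set (ℝ × ℝ)) (α : ℝ) (p : ℝ × ℝ) : Prop :=
  ∃ ε > 0, (∃ γ₁ γ₂ : ℝ → ℝ × ℝ, C2HolderOn α γ₁ (Icc 0 1) ∧ C2HolderOn α γ₂ (Icc 0 1) ∧
      γ₁ 0 = p ∧ γ₂ 0 = p ∧
      frontier Ω ∩ Metric.ball p ε = (γ₁ '' Ico 0 1 ∪ γ₂ '' Ico 0 1) ∩ Metric.ball p ε) ∧
    ∃ w : ℝ × ℝ, ∃ c > 0, ∀ x ∈ Ω ∩ Metric.ball p ε,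
      c * ‖x - p‖ ≤ (x - p).1 * w.1 + (x - p).2 * w.2

/-- `Ω` has a continuous boundary which is piecewise of class `C^{2,α}` for some `α > 0`,
with at most finitely many corners, each of aperture less than `π`. -/
def HasPiecewiseC2Boundary (Ω : Set (ℝ × ℝ)) : Prop :=
  ∃ α > 0, ∃ S : Finset (ℝ × ℝ), ↑S ⊆ frontier Ω ∧
    (∀ p ∈ frontier Ω \ (S : Set (ℝ × ℝ)), IsLocallyC2CurveAt α (frontier Ω) p) ∧
    ∀ p ∈ S, HasConvexCornerAt Ω α p

/-- Assumption (R): `Ω` is bounded and open with continuous, piecewise `C^{2,α}` boundary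
having finitely many corners of aperture `< π`, and `B` extends continuously to `closure Ω`. -/
structure AssumptionR (Ω : Set (ℝ × ℝ)) (B : ℝ × ℝ → ℝ) : Prop where
  isOpen : IsOpen Ω
  bounded : Bornology.IsBounded Ω
  bdryReg : HasPiecewiseC2Boundary Ω
  fieldCont : ContinuousOn B (closure Ω)

/-- The oscillation of `ψ` over `Ω`. -/
def osc (ψ : ℝ × ℝ → ℝ) (Ω : Set (ℝ × ℝ)) : ℝ := sSup (ψ '' Ω) - sInf (ψ '' Ω)

/-- The region enclosed by `Γ`: the union of the bounded connected components of `Γᶜ`. -/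
def curveInterior (Γ : Set (ℝ × ℝ)) : Set (ℝ × ℝ) :=
  {x | x ∉ Γ ∧ Bornology.IsBounded (connectedComponentIn Γᶜ x)}

/-- `Γ` is a simple closed curve of class `C^{2,α}`. -/
def IsC2ClosedCurve (α : ℝ) (Γ : Set (ℝ × ℝ)) : Prop :=
  ∃ γ : ℝ → ℝ × ℝ, Function.Periodic γ 1 ∧ C2HolderOn α γ (Icc 0 1) ∧
    InjOn γ (Ico 0 1) ∧ Γ = γ '' Icc 0 1

/-- The ground state energy `λ^D(Ω)` of the Dirichlet Laplacian on `Ω`. -/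
def dirichletGSE (Ω : Set (ℝ × ℝ)) : ℝ :=
  sInf ((fun u : ℝ × ℝ → ℝ =>
      (∫ x in Ω, (pd1 u x ^ 2 + pd2 u x ^ 2)) / ∫ x in Ω, u x ^ 2) ''
    {u | ContDiff ℝ (⊤ : ℕ∞) u ∧ HasCompactSupport u ∧ tsupport u ⊆ Ω ∧ u ≠ 0})

/-- The open disc of radius `R` centred at the origin (with the Euclidean distance). -/
def disc (R : ℝ) : Set (ℝ × ℝ) := {y : ℝ × ℝ | y.1 ^ 2 + y.2 ^ 2 < R ^ 2}

end

theorem pd1_eq_of_hasDerivAt {u : ℝ × ℝ → ℝ} {x : ℝ × ℝ} {d : ℝ} (hu : DifferentiableAt ℝ u x)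
    (hd : HasDerivAt (fun t => u (t, x.2)) d x.1) : pd1 u x = d :=
  (hu.hasFDerivAt.comp_hasDerivAt x.1
    ((hasDerivAt_id x.1).prodMk (hasDerivAt_const x.1 x.2))).unique hd

theorem pd2_eq_of_hasDerivAt {u : ℝ × ℝ → ℝ} {x : ℝ × ℝ} {d : ℝ} (hu : DifferentiableAt ℝ u x)
    (hd : HasDerivAt (fun t => u (x.1, t)) d x.2) : pd2 u x = d :=
  (hu.hasFDerivAt.comp_hasDerivAt x.2
    ((hasDerivAt_const x.2 x.1).prodMk (hasDerivAt_id x.2))).unique hd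

theorem hasDerivAt_sextic (a b c d e f g t : ℝ) :
    HasDerivAt (fun t => a + b * t + c * t ^ 2 + d * t ^ 3 + e * t ^ 4 + f * t ^ 5 + g * t ^ 6)
      (b + 2 * c * t + 3 * d * t ^ 2 + 4 * e * t ^ 3 + 5 * f * t ^ 4 + 6 * g * t ^ 5) t := by
  have h (k : ℝ) (n : ℕ) : HasDerivAt (fun t : ℝ => k * t ^ n) (k * (n * t ^ (n - 1))) t :=
    (hasDerivAt_pow n t).const_mul k
  refine (((((((hasDerivAt_const t a).add ((hasDerivAt_id t).const_mul b)).add (h c 2)).add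
    (h d 3)).add (h e 4)).add (h f 5)).add (h g 6)).congr_deriv ?_
  push_cast
  ring

/-- Section 7, second example: the magnetic field `Δψ₀` and the
outward normal derivative of `ψ₀` on the unit circle. -/
theorem second_example_field_and_normal_derivative (ψ : ℝ × ℝ → ℝ)
    (hψ : ψ = fun x => (1 - x.1 ^ 2 - x.2 ^ 2) * (6 * x.1 ^ 2 + 3 * x.2 ^ 2 - x.2 ^ 4 - 1)) :
    (∀ x : ℝ × ℝ, lap ψ x =
      22 - 90 * x.1 ^ 2 - 66 * x.2 ^ 2 + 12 * x.1 ^ 2 * x.2 ^ 2 + 32 * x.2 ^ 4) ∧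
    (∀ x : ℝ × ℝ, x.1 ^ 2 + x.2 ^ 2 = 1 →
      x.1 * pd1 ψ x + x.2 * pd2 ψ x
          = -2 * (6 * x.1 ^ 2 + 3 * x.2 ^ 2 - x.2 ^ 4 - 1) ∧
      x.1 * pd1 ψ x + x.2 * pd2 ψ x ≤ -2) := by
  have h1 : pd1 ψ = fun x => 14 * x.1 - 24 * x.1 ^ 3 - 18 * x.1 * x.2 ^ 2
      + 2 * x.1 * x.2 ^ 4 := by
    funext x
    refine pd1_eq_of_hasDerivAt (by subst hψ; fun_prop) ?_
    convert hasDerivAt_sextic (-1 + 4 * x.2 ^ 2 - 4 * x.2 ^ 4 + x.2 ^ 6) 0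
      (7 - 9 * x.2 ^ 2 + x.2 ^ 4) 0 (-6) 0 0 x.1 using 1
    · funext t
      simp only [hψ]
      ring
    · ring
  have h2 : pd2 ψ = fun x => 8 * x.2 - 18 * x.1 ^ 2 * x.2 - 16 * x.2 ^ 3
      + 4 * x.1 ^ 2 * x.2 ^ 3 + 6 * x.2 ^ 5 := by
    funext x
    refine pd2_eq_of_hasDerivAt (by subst hψ; fun_prop) ?_
    convert hasDerivAt_sextic (-1 + 7 * x.1 ^ 2 - 6 * x.1 ^ 4) 0
      (4 - 9 * x.1 ^ 2) 0 (-4 + x.1 ^ 2) 0 1 x.2 using 1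
    · funext t
      simp only [hψ]
      ring
    · ring
  have h11 (x : ℝ × ℝ) : pd1 (pd1 ψ) x = 14 - 72 * x.1 ^ 2 - 18 * x.2 ^ 2 + 2 * x.2 ^ 4 := by
    rw [h1]
    refine pd1_eq_of_hasDerivAt (by fun_prop) ?_
    convert hasDerivAt_sextic 0 (14 - 18 * x.2 ^ 2 + 2 * x.2 ^ 4) 0 (-24) 0 0 0 x.1 using 1
    · funext t
      ring
    · ring
  have h22 (x : ℝ × ℝ) : pd2 (pd2 ψ) x = 8 - 18 * x.1 ^ 2 - 48 * x.2 ^ 2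
      + 12 * x.1 ^ 2 * x.2 ^ 2 + 30 * x.2 ^ 4 := by
    rw [h2]
    refine pd2_eq_of_hasDerivAt (by fun_prop) ?_
    convert hasDerivAt_sextic 0 (8 - 18 * x.1 ^ 2) 0 (-16 + 4 * x.1 ^ 2) 0 6 0 x.2 using 1
    · funext t
      ring
    · ring
  refine ⟨fun x => ?_, fun x hx => ?_⟩
  · rw [lap, h11, h22]
    ring
  · have hnormal : x.1 * pd1 ψ x + x.2 * pd2 ψ x
        = -2 * (6 * x.1 ^ 2 + 3 * x.2 ^ 2 - x.2 ^ 4 - 1) := by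
      have hx1 : x.1 ^ 2 = 1 - x.2 ^ 2 := by linarith
      have hx4 : x.1 ^ 4 = (1 - x.2 ^ 2) ^ 2 := by rw [← hx1]; ring
      rw [h1, h2]
      ring_nf
      rw [hx4, hx1]
      ring
    refine ⟨hnormal, ?_⟩
    rw [hnormal]
    nlinarith [sq_nonneg x.1, sq_nonneg x.2]
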